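/- Let X be a second countable, locally compact Hausdorff space and H_X an X-module. Then RL*_c(H_X) coincides with the norm closure, inside C_b([1,∞), 𝒦(H_X)), of the *-algebra ℝ𝕃^{alg}_c(H_X) consisting of bounded norm-continuous functions T : [1,∞) → 𝒦(H_X) such that (1) T has eventually uniform compact support, i.e. there are a compact K ⊆ X and t₀ ≥ 1 with supp(T_t) ⊆ K × K for all t ≥ t₀, and (2) for every open neighbourhood U of the diagonal in X⁺ × X⁺ there exists t_U ≥ 1 such that supp(T_t) ⊆ U for all t > t_U. -/

import Mathlib

open scoped ZeroAtInfty
open Filter Topology MeasureTheory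

noncomputable section

namespace Stmt

variable {X : Type*} [TopologicalSpace X]
variable {H : Type*} [NormedAddCommGroup H] [InnerProductSpace ℂ H] [CompleteSpace H]

/-- `π` is a nondegenerate ⋆-representation of `C₀(X, ℂ)` on the Hilbert space `H`,
i.e. `H` is an `X`-module. -/
structure IsStarRep (π : C₀(X, ℂ) → H →L[ℂ] H) : Prop where
  map_add : ∀ φ ψ, π (φ + ψ) = π φ + π ψ
  map_smul : ∀ (a : ℂ) (φ), π (a • φ) = a • π φ
  map_mul : ∀ φ ψ, π (φ * ψ) = (π φ).comp (π ψ)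
  map_star : ∀ φ, ContinuousLinearMap.adjoint (π φ) = π (star φ)
  nondeg : Dense (↑(Submodule.span ℂ (Set.range fun p : C₀(X, ℂ) × H => π p.1 p.2)) : Set H)

/-- The support of an operator `T` on an `X`-module: the set of pairs `(y, x) ∈ X × X`
near which `T` does not vanish. -/
def opSupport (π : C₀(X, ℂ) → H →L[ℂ] H) (T : H →L[ℂ] H) : Set (X × X) :=
  {p | ∀ U V : Set X, IsOpen U → IsOpen V → p.2 ∈ U → p.1 ∈ V →
      ∃ φ ψ : C₀(X, ℂ), tsupport ⇑φ ⊆ U ∧ tsupport ⇑ψ ⊆ V ∧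
        (π ψ).comp (T.comp (π φ)) ≠ 0}

/-- The function `x ↦ f x - f ∞` on `X`, for `f` a continuous function on the one-point
compactification of `X`; it vanishes at infinity. -/
def onePointRestrict (f : C(OnePoint X, ℂ)) : C₀(X, ℂ) where
  toFun x := f x - f OnePoint.infty
  continuous_toFun := (f.continuous.comp OnePoint.continuous_coe).sub continuous_const
  zero_at_infty' := by
    have h1 : Tendsto ((↑) : X → OnePoint X) (cocompact X) (𝓝 (OnePoint.infty)) :=
      OnePoint.tendsto_coe_infty.mono_left cocompact_le_coclosedCompact
    have h2 : Tendsto (fun x : X => f x - f OnePoint.infty) (cocompact X)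
        (𝓝 (f OnePoint.infty - f OnePoint.infty)) :=
      ((f.continuous.tendsto _).comp h1).sub tendsto_const_nhds
    simpa using h2

/-- The canonical action of `C(X⁺, ℂ)` on an `X`-module, extending the action of
`C₀(X, ℂ)` unitally (`X⁺` being the one-point compactification of `X`). -/
def onePointAct (π : C₀(X, ℂ) → H →L[ℂ] H) (f : C(OnePoint X, ℂ)) : H →L[ℂ] H :=
  f OnePoint.infty • (1 : H →L[ℂ] H) + π (onePointRestrict f)

/-- The support of an operator on an `X`-module, viewed as a module over the one-point
compactification `X⁺`. -/
def opSupportPlus (π : C₀(X, ℂ) → H →L[ℂ] H) (T : H →L[ℂ] H) :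
    Set (OnePoint X × OnePoint X) :=
  {p | ∀ U V : Set (OnePoint X), IsOpen U → IsOpen V → p.2 ∈ U → p.1 ∈ V →
      ∃ f g : C(OnePoint X, ℂ), tsupport ⇑f ⊆ U ∧ tsupport ⇑g ⊆ V ∧
        (onePointAct π g).comp (T.comp (onePointAct π f)) ≠ 0}

/-- A family of operators indexed by `[1, ∞)` (modelled on `ℝ`) is bounded in norm. -/
def OpBdd (T : ℝ → H →L[ℂ] H) : Prop :=
  ∃ C : ℝ, ∀ t : ℝ, 1 ≤ t → ‖T t‖ ≤ C

/-- `lim_{t → ∞} ‖[φ, T_t]‖ = 0` for every `φ ∈ C₀(X)`. -/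
def CommDecay (π : C₀(X, ℂ) → H →L[ℂ] H) (T : ℝ → H →L[ℂ] H) : Prop :=
  ∀ φ : C₀(X, ℂ),
    Tendsto (fun t => ‖(π φ).comp (T t) - (T t).comp (π φ)‖) atTop (𝓝 0)

/-- The supports of the `T_t`, viewed in `X⁺ × X⁺`, are eventually contained in any given
open neighbourhood of the diagonal. -/
def SmallSuppPlus (π : C₀(X, ℂ) → H →L[ℂ] H) (S : ℝ → H →L[ℂ] H) : Prop :=
  ∀ U : Set (OnePoint X × OnePoint X), IsOpen U → (∀ z, (z, z) ∈ U) →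
    ∃ tU : ℝ, 1 ≤ tU ∧ ∀ t > tU, opSupportPlus π (S t) ⊆ U

/-- Uniform closure (over `[1, ∞)`, in the sup-norm) of a set of operator-valued
functions; this is the norm closure inside `C_b([1,∞), 𝒦(H))` when applied to sets of
bounded continuous compact-operator valued functions. -/
def UnifClosure (A : Set (ℝ → H →L[ℂ] H)) : Set (ℝ → H →L[ℂ] H) :=
  {T | ∀ ε > (0 : ℝ), ∃ S ∈ A, ∀ t : ℝ, 1 ≤ t → ‖T t - S t‖ ≤ ε}

/-- The ⋆-algebra `RL^{alg}_c(H_X)`: bounded, norm-continuous, compact-operator valued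
functions on `[1, ∞)` with uniform compact support and commutator decay. -/
def RLalg (π : C₀(X, ℂ) → H →L[ℂ] H) : Set (ℝ → H →L[ℂ] H) :=
  {T | OpBdd T ∧ ContinuousOn T (Set.Ici 1) ∧
    (∀ t : ℝ, 1 ≤ t → IsCompactOperator ⇑(T t)) ∧
    (∃ K : Set X, IsCompact K ∧ ∀ t : ℝ, 1 ≤ t → opSupport π (T t) ⊆ K ×ˢ K) ∧
    CommDecay π T}

/-- The representable localization algebra `RL^*_c(H_X)` (as a set of operator-valued
functions on `[1, ∞)`): the uniform closure of `RL^{alg}_c(H_X)`. -/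
def RLc (π : C₀(X, ℂ) → H →L[ℂ] H) : Set (ℝ → H →L[ℂ] H) :=
  UnifClosure (RLalg π)

/-- The ⋆-algebra `ℝ𝕃^{alg}_c(H_X)`: bounded, norm-continuous, compact-operator valued
functions with (1) eventually uniform compact support, and (2) supports (in `X⁺ × X⁺`)
eventually inside every open neighbourhood of the diagonal. -/
def RLalgEv (π : C₀(X, ℂ) → H →L[ℂ] H) : Set (ℝ → H →L[ℂ] H) :=
  {T | OpBdd T ∧ ContinuousOn T (Set.Ici 1) ∧
    (∀ t : ℝ, 1 ≤ t → IsCompactOperator ⇑(T t)) ∧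
    (∃ (K : Set X) (t₀ : ℝ), IsCompact K ∧ 1 ≤ t₀ ∧
      ∀ t : ℝ, t₀ ≤ t → opSupport π (T t) ⊆ K ×ˢ K) ∧
    SmallSuppPlus π T}

section LocalOperators

variable {Y : Type*} [TopologicalSpace Y]

/-- A real-valued continuous function viewed as a complex-valued one. -/
def complexify (f : C(Y, ℝ)) : C(Y, ℂ) :=
  ⟨fun y => (f y : ℂ), Complex.continuous_ofReal.comp f.continuous⟩

@[simp] lemma complexify_apply (f : C(Y, ℝ)) (y : Y) : complexify f y = (f y : ℂ) := rfl

lemma star_complexify (f : C(Y, ℝ)) : star (complexify f) = complexify f := by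
  ext y
  simp

/-- The function `s ↦ s` truncated to `[0, 1]`. -/
def clamp (s : ℝ) : ℝ := min 1 (max 0 s)

/-- The `i`-th tent function of width `1 / N`, evaluated at `G`. -/
def tent (G : C(Y, ℝ)) (N i : ℕ) : C(Y, ℝ) where
  toFun y := clamp (N * G y - i + 1) - clamp (N * G y - i)
  continuous_toFun := by unfold clamp; fun_prop

lemma tent_apply (G : C(Y, ℝ)) (N i : ℕ) (y : Y) :
    tent G N i y = clamp (N * G y - i + 1) - clamp (N * G y - i) := rfl

lemma abs_tent_le (G : C(Y, ℝ)) (N i : ℕ) (y : Y) : |tent G N i y| ≤ 1 := by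
  rw [tent_apply, abs_le]
  unfold clamp
  constructor <;> grind

lemma abs_le_of_tent_ne_zero {G : C(Y, ℝ)} {N i : ℕ} {y : Y} (h : tent G N i y ≠ 0) :
    |N * G y - i| ≤ 1 := by
  contrapose! h
  rw [tent_apply]
  unfold clamp
  grind

lemma sum_tent {G : C(Y, ℝ)} (hG : ∀ y, G y ∈ Set.Icc (0 : ℝ) 1) (N : ℕ) :
    ∑ i ∈ Finset.range (N + 1), complexify (tent G N i) = 1 := by
  ext y
  have h := Finset.sum_range_sub' (fun i : ℕ => clamp (N * G y - i + 1)) (N + 1)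
  have h0 : clamp (N * G y - (0 : ℕ) + 1) = 1 := by
    have : 0 ≤ N * G y := mul_nonneg N.cast_nonneg (hG y).1
    unfold clamp; grind
  have h1 : clamp (N * G y - (N + 1 : ℕ) + 1) = 0 := by
    have : N * G y ≤ N := mul_le_of_le_one_right N.cast_nonneg (hG y).2
    unfold clamp; push_cast; grind
  rw [h0, h1, sub_zero] at h
  simp only [ContinuousMap.coe_sum, Finset.sum_apply, complexify_apply, ContinuousMap.one_apply,
    tent_apply]
  rw [← Complex.ofReal_sum, Complex.ofReal_eq_one]
  refine (Finset.sum_congr rfl fun i _ => ?_).trans h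
  congr 2
  push_cast
  ring

variable {B : Type*} [CStarAlgebra B]

lemma sum_map_tent (ρ : C(Y, ℂ) →⋆ₐ[ℂ] B) {G : C(Y, ℝ)} (hG : ∀ y, G y ∈ Set.Icc (0 : ℝ) 1)
    (N : ℕ) : ∑ i ∈ Finset.range (N + 1), ρ (complexify (tent G N i)) = 1 := by
  rw [← map_sum, sum_tent hG, map_one]

variable [CompactSpace Y]

lemma norm_map_le (ρ : C(Y, ℂ) →⋆ₐ[ℂ] B) {f : C(Y, ℂ)} {c : ℝ} (hc : 0 ≤ c)
    (hf : ∀ y, ‖f y‖ ≤ c) : ‖ρ f‖ ≤ c :=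
  (NonUnitalStarAlgHom.norm_apply_le ρ f).trans ((ContinuousMap.norm_le f hc).2 hf)

lemma norm_map_mul_tent_le (ρ : C(Y, ℂ) →⋆ₐ[ℂ] B) {G : C(Y, ℝ)} {N i : ℕ} {h : C(Y, ℂ)}
    {c : ℝ} (hc : 0 ≤ c) (hh : ∀ y, |N * G y - i| ≤ 1 → ‖h y‖ ≤ c) :
    ‖ρ (complexify (tent G N i) * h)‖ ≤ c := by
  refine norm_map_le ρ hc fun y => ?_
  by_cases h0 : tent G N i y = 0
  · simpa [h0] using hc
  · rw [ContinuousMap.mul_apply, norm_mul, complexify_apply, Complex.norm_real, Real.norm_eq_abs]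
    calc _ ≤ 1 * c := mul_le_mul (abs_tent_le G N i y) (hh y (abs_le_of_tent_ne_zero h0))
          (norm_nonneg _) zero_le_one
      _ = c := one_mul c

/-- Iterating the commutator with `ρ G` twice. -/
lemma norm_tent_mul_commutator_mul_tent_le (ρ : C(Y, ℂ) →⋆ₐ[ℂ] B) {G : C(Y, ℝ)} {N : ℕ}
    (hN : 0 < N) {i j : ℕ} (hij : |(i : ℝ) - j| ≤ 4) (T : B) :
    ‖ρ (complexify (tent G N i)) *
        ⁅ρ (complexify G), ⁅ρ (complexify G), T⁆⁆ * ρ (complexify (tent G N j))‖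
      ≤ 36 * ‖T‖ / N ^ 2 := by
  have hN' : (0 : ℝ) < N := by exact_mod_cast hN
  set D : C(Y, ℂ) := complexify (G - ContinuousMap.const Y ((i : ℝ) / N)) with hD
  have hDG : ρ (complexify G) = ρ D + algebraMap ℂ B ((i : ℂ) / N) := by
    rw [← AlgHomClass.commutes ρ, ← map_add]
    congr 1
    ext y
    simp [hD, Algebra.algebraMap_eq_smul_one]
  have hcomm (S : B) : ⁅ρ (complexify G), S⁆ = ρ D * S - S * ρ D := by
    rw [hDG, Ring.lie_def, add_mul, mul_add, Algebra.commutes ((i : ℂ) / N) S]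
    abel
  have hexp : ρ (complexify (tent G N i)) *
        ⁅ρ (complexify G), ⁅ρ (complexify G), T⁆⁆ * ρ (complexify (tent G N j))
      = ρ (complexify (tent G N i) * (D * D)) * T * ρ (complexify (tent G N j) * 1)
        - ρ (complexify (tent G N i) * D) * T * ρ (complexify (tent G N j) * D)
        - ρ (complexify (tent G N i) * D) * T * ρ (complexify (tent G N j) * D)
        + ρ (complexify (tent G N i) * 1) * T * ρ (complexify (tent G N j) * (D * D)) := by
    rw [hcomm, hcomm, mul_comm (complexify (tent G N j)) (D * D),
      mul_comm (complexify (tent G N j)) D]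
    simp only [map_mul, mul_one]
    noncomm_ring
  have hDi (y : Y) (hy : |N * G y - i| ≤ 1) : ‖D y‖ ≤ 1 / N := by
    have : G y - i / N = (N * G y - i) / N := by field_simp
    simp only [hD, complexify_apply, ContinuousMap.sub_apply, ContinuousMap.const_apply, this,
      Complex.norm_real, Real.norm_eq_abs, abs_div, Nat.abs_cast]
    gcongr
  have hDj (y : Y) (hy : |N * G y - j| ≤ 1) : ‖D y‖ ≤ 5 / N := by
    have : G y - i / N = (N * G y - i) / N := by field_simp
    simp only [hD, complexify_apply, ContinuousMap.sub_apply, ContinuousMap.const_apply, this,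
      Complex.norm_real, Real.norm_eq_abs, abs_div, Nat.abs_cast]
    gcongr
    grind
  have i2 : ‖ρ (complexify (tent G N i) * (D * D))‖ ≤ 1 / N * (1 / N) :=
    norm_map_mul_tent_le ρ (by positivity) fun y hy => by
      rw [ContinuousMap.mul_apply, norm_mul]
      exact mul_le_mul (hDi y hy) (hDi y hy) (norm_nonneg _) (by positivity)
  have j2 : ‖ρ (complexify (tent G N j) * (D * D))‖ ≤ 5 / N * (5 / N) :=
    norm_map_mul_tent_le ρ (by positivity) fun y hy => by
      rw [ContinuousMap.mul_apply, norm_mul]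
      exact mul_le_mul (hDj y hy) (hDj y hy) (norm_nonneg _) (by positivity)
  have i1 : ‖ρ (complexify (tent G N i) * D)‖ ≤ 1 / N := norm_map_mul_tent_le ρ (by positivity) hDi
  have j1 : ‖ρ (complexify (tent G N j) * D)‖ ≤ 5 / N := norm_map_mul_tent_le ρ (by positivity) hDj
  have i0 : ‖ρ (complexify (tent G N i) * 1)‖ ≤ 1 :=
    norm_map_mul_tent_le ρ (by positivity) (by simp)
  have j0 : ‖ρ (complexify (tent G N j) * 1)‖ ≤ 1 :=
    norm_map_mul_tent_le ρ (by positivity) (by simp)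
  have key {P Q : B} {p q : ℝ} (hP : ‖P‖ ≤ p) (hQ : ‖Q‖ ≤ q) : ‖P * T * Q‖ ≤ p * ‖T‖ * q := by
    have hp : 0 ≤ p := (norm_nonneg _).trans hP
    exact (norm_mul₃_le).trans (by gcongr)
  rw [hexp]
  calc _ ≤ 1 / N * (1 / N) * ‖T‖ * 1 + 1 / N * ‖T‖ * (5 / N) + 1 / N * ‖T‖ * (5 / N)
        + 1 * ‖T‖ * (5 / N * (5 / N)) :=
      (norm_add_le _ _).trans <| add_le_add ((norm_sub_le _ _).trans <| add_le_add
        ((norm_sub_le _ _).trans <| add_le_add (key i2 j0) (key i1 j1)) (key i1 j1)) (key i0 j2)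
    _ = 36 * ‖T‖ / N ^ 2 := by field_simp; norm_num

lemma norm_commutator_commutator_le (ρ : C(Y, ℂ) →⋆ₐ[ℂ] B) {G : C(Y, ℝ)}
    (hG : ∀ y, G y ∈ Set.Icc (0 : ℝ) 1) {N : ℕ} (hN : 0 < N) (T : B)
    (hT : ∀ i j : ℕ, 4 < |(i : ℝ) - j| →
      ρ (complexify (tent G N i)) * T * ρ (complexify (tent G N j)) = 0) :
    ‖⁅ρ (complexify G), ⁅ρ (complexify G), T⁆⁆‖ ≤ 648 * ‖T‖ / N := by
  have hN' : (1 : ℝ) ≤ N := by exact_mod_cast hN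
  set τ : ℕ → B := fun i => ρ (complexify (tent G N i)) with hτ
  set K := ⁅ρ (complexify G), ⁅ρ (complexify G), T⁆⁆ with hK
  have hcomm (i : ℕ) : Commute (ρ (complexify G)) (τ i) := by
    rw [commute_iff_eq, hτ, ← map_mul, ← map_mul, mul_comm]
  have hfar (i j : ℕ) (h : 4 < |(i : ℝ) - j|) : τ i * K * τ j = 0 := by
    have h1 : τ i * ρ (complexify G) = ρ (complexify G) * τ i := (hcomm i).eq.symm
    have h2 : ρ (complexify G) * τ j = τ j * ρ (complexify G) := (hcomm j).eq
    have h0 : τ i * T * τ j = 0 := hT i j h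
    have hS (S : B) (hS : τ i * S * τ j = 0) : τ i * ⁅ρ (complexify G), S⁆ * τ j = 0 := by
      calc _ = (τ i * ρ (complexify G)) * S * τ j - τ i * S * (ρ (complexify G) * τ j) := by
            rw [Ring.lie_def]; noncomm_ring
        _ = ρ (complexify G) * (τ i * S * τ j) - (τ i * S * τ j) * ρ (complexify G) := by
            rw [h1, h2]; noncomm_ring
        _ = 0 := by rw [hS]; simp
    exact hS _ (hS _ h0)
  have hsum : K = ∑ i ∈ Finset.range (N + 1), ∑ j ∈ Finset.range (N + 1), τ i * K * τ j := by
    simp_rw [← Finset.mul_sum, ← Finset.sum_mul]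
    rw [sum_map_tent ρ hG, one_mul, mul_one]
  have hrow (i : ℕ) : ∑ j ∈ Finset.range (N + 1), ‖τ i * K * τ j‖ ≤ 9 * (36 * ‖T‖ / N ^ 2) := by
    have hsub : ((Finset.range (N + 1)).filter fun j => j ∈ Finset.Icc (i - 4) (i + 4)).card ≤ 9 := by
      refine (Finset.card_le_card (t := Finset.Icc (i - 4) (i + 4)) fun j hj => ?_).trans ?_
      · exact (Finset.mem_filter.1 hj).2
      · rw [Nat.card_Icc]; omega
    rw [← Finset.sum_filter_of_ne (p := fun j => j ∈ Finset.Icc (i - 4) (i + 4))]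
    · refine (Finset.sum_le_card_nsmul _ _ (36 * ‖T‖ / N ^ 2) fun j hj => ?_).trans ?_
      · by_cases h : |(i : ℝ) - j| ≤ 4
        · exact norm_tent_mul_commutator_mul_tent_le ρ hN h T
        · rw [hfar i j (not_le.1 h), norm_zero]; positivity
      · rw [nsmul_eq_mul]
        gcongr
        exact_mod_cast hsub
    · intro j _ hj
      by_contra hmem
      refine hj ?_
      rw [hfar i j, norm_zero]
      rw [lt_abs]
      rw [Finset.mem_Icc, not_and_or, not_le, not_le] at hmem
      rcases hmem with h | h
      · left
        have : j + 4 < i := by omega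
        have : (j : ℝ) + 4 < i := by exact_mod_cast this
        linarith
      · right
        have : (i : ℝ) + 4 < j := by exact_mod_cast h
        linarith
  calc ‖K‖ ≤ ∑ i ∈ Finset.range (N + 1), ∑ j ∈ Finset.range (N + 1), ‖τ i * K * τ j‖ := by
        conv_lhs => rw [hsum]
        exact norm_sum_le_of_le _ fun i _ => norm_sum_le _ _
    _ ≤ (N + 1 : ℕ) * (9 * (36 * ‖T‖ / N ^ 2)) := by
        refine (Finset.sum_le_card_nsmul _ _ _ fun i _ => hrow i).trans ?_
        rw [nsmul_eq_mul, Finset.card_range]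
    _ ≤ (2 * N) * (9 * (36 * ‖T‖ / N ^ 2)) := by
        gcongr
        push_cast
        linarith
    _ = 648 * ‖T‖ / N := by field_simp; ring

lemma sq_norm_commutator_le (ρ : C(Y, ℂ) →⋆ₐ[ℂ] B) {G : C(Y, ℝ)}
    (hG : ∀ y, G y ∈ Set.Icc (0 : ℝ) 1) {N : ℕ} (hN : 0 < N) (T : B)
    (hT : ∀ i j : ℕ, 2 < |(i : ℝ) - j| →
      ρ (complexify (tent G N i)) * T * ρ (complexify (tent G N j)) = 0) :
    ‖⁅ρ (complexify G), T⁆‖ ^ 2 ≤ 972 * ‖T‖ ^ 2 / N := by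
  set A := ρ (complexify G) with hA
  have hstar (f : C(Y, ℝ)) : star (ρ (complexify f)) = ρ (complexify f) := by
    rw [← map_star, star_complexify]
  have hTs (i j : ℕ) (h : 2 < |(i : ℝ) - j|) :
      ρ (complexify (tent G N i)) * star T * ρ (complexify (tent G N j)) = 0 := by
    have := congrArg star (hT j i (by rwa [abs_sub_comm]))
    simpa [hstar, mul_assoc] using this
  have b1 := norm_commutator_commutator_le ρ hG hN T fun i j h => hT i j (by linarith)
  have b2 := norm_commutator_commutator_le ρ hG hN (star T) fun i j h => hTs i j (by linarith)
  have b3 := norm_commutator_commutator_le ρ hG hN (T * star T) fun i j h => by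
    have : ρ (complexify (tent G N i)) * (T * star T) * ρ (complexify (tent G N j))
        = ∑ k ∈ Finset.range (N + 1), (ρ (complexify (tent G N i)) * T *
          ρ (complexify (tent G N k))) * (star T * ρ (complexify (tent G N j))) := by
      rw [← Finset.sum_mul, ← Finset.mul_sum, sum_map_tent ρ hG, mul_one]
      noncomm_ring
    rw [this]
    refine Finset.sum_eq_zero fun k _ => ?_
    by_cases hik : 2 < |(i : ℝ) - k|
    · rw [hT i k hik, zero_mul]
    · rw [mul_assoc, ← mul_assoc _ (star T), hTs k j (by grind), mul_zero]
  rw [← hA] at b1 b2 b3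
  rw [norm_star] at b2
  rw [CStarRing.norm_self_mul_star] at b3
  have hid : (2 : ℂ) • (⁅A, T⁆ * star ⁅A, T⁆)
      = ⁅A, ⁅A, T⁆⁆ * star T + T * ⁅A, ⁅A, star T⁆⁆ - ⁅A, ⁅A, T * star T⁆⁆ := by
    have : star A = A := hstar G
    simp only [Ring.lie_def, star_sub, star_mul, this, two_smul]
    noncomm_ring
  have hn := congrArg norm hid
  rw [norm_smul, CStarRing.norm_self_mul_star, Complex.norm_ofNat] at hn
  have hle : ‖⁅A, ⁅A, T⁆⁆ * star T + T * ⁅A, ⁅A, star T⁆⁆ - ⁅A, ⁅A, T * star T⁆⁆‖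
      ≤ 648 * ‖T‖ / N * ‖T‖ + ‖T‖ * (648 * ‖T‖ / N) + 648 * (‖T‖ * ‖T‖) / N := by
    refine (norm_sub_le _ _).trans (add_le_add ((norm_add_le _ _).trans (add_le_add ?_ ?_)) b3)
    · refine (norm_mul_le _ _).trans ?_
      rw [norm_star]
      gcongr
    · refine (norm_mul_le _ _).trans ?_
      gcongr
  rw [← hn] at hle
  have : 648 * ‖T‖ / N * ‖T‖ + ‖T‖ * (648 * ‖T‖ / N) + 648 * (‖T‖ * ‖T‖) / N
      = 2 * (972 * ‖T‖ ^ 2 / N) := by ring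
  nlinarith

end LocalOperators

section Supports

variable {Z : Type*} [TopologicalSpace Z] [T2Space Z] [LocallyCompactSpace Z]

/-- A compactly supported function is a finite sum of functions subordinate to a given
open cover of its support. -/
lemma exists_sum_eq_of_cover {f : C(Z, ℂ)} (hf : HasCompactSupport f) {U : Z → Set Z}
    (hU : ∀ x ∈ tsupport f, IsOpen (U x) ∧ x ∈ U x) :
    ∃ (n : ℕ) (x : Fin n → Z) (g : Fin n → C(Z, ℂ)), (∀ i, x i ∈ tsupport f) ∧ ∑ i, g i = f ∧
      ∀ i, HasCompactSupport (g i) ∧ tsupport (g i) ⊆ U (x i) := by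
  obtain ⟨s, hs⟩ := IsCompact.elim_finite_subcover (show IsCompact (tsupport f) from hf)
    (fun x : tsupport f => U x) (fun x => (hU x x.2).1)
    (fun x hx => Set.mem_iUnion.2 ⟨⟨x, hx⟩, (hU x hx).2⟩)
  let x : Fin s.card → Z := fun i => (s.equivFin.symm i : tsupport f)
  have hx (i) : x i ∈ tsupport f := (s.equivFin.symm i : tsupport f).2
  obtain ⟨p, hp, hp1, -, -⟩ := exists_continuous_sum_one_of_isOpen_isCompact
    (s := fun i => U (x i)) (fun i => (hU _ (hx i)).1) hf (by
      intro z hz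
      obtain ⟨y, hy, hzy⟩ := Set.mem_iUnion₂.1 (hs hz)
      exact Set.mem_iUnion.2 ⟨s.equivFin ⟨y, hy⟩, by simpa [x] using hzy⟩)
  refine ⟨s.card, x, fun i => complexify (p i) * f, hx, ?_, fun i => ⟨?_, ?_⟩⟩
  · ext z
    rw [← Finset.sum_mul, ContinuousMap.mul_apply, ContinuousMap.sum_apply]
    by_cases hz : z ∈ tsupport f
    · have h1 : ∑ i, p i z = 1 := by simpa using hp1 hz
      simp only [complexify_apply]
      rw [← Complex.ofReal_sum, h1, Complex.ofReal_one, one_mul]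
    · rw [image_eq_zero_of_notMem_tsupport hz, mul_zero]
  · exact HasCompactSupport.mul_left hf
  · refine Set.Subset.trans (closure_mono fun z hz => ?_) (hp i)
    rw [Function.mem_support] at hz ⊢
    intro h
    exact hz (by simp [h])

/-- A biadditive relation on compactly supported functions which holds locally near the points
of `tsupport g ×ˢ tsupport f` holds for `(g, f)`. -/
lemma rel_of_forall_exists_isOpen {Q : C(Z, ℂ) → C(Z, ℂ) → Prop}
    (zero_left : ∀ f : C(Z, ℂ), HasCompactSupport f → Q 0 f)
    (zero_right : ∀ g : C(Z, ℂ), HasCompactSupport g → Q g 0)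
    (add_left : ∀ g₁ g₂ f, Q g₁ f → Q g₂ f → Q (g₁ + g₂) f)
    (add_right : ∀ g f₁ f₂, Q g f₁ → Q g f₂ → Q g (f₁ + f₂))
    {f g : C(Z, ℂ)} (hf : HasCompactSupport f) (hg : HasCompactSupport g)
    (h : ∀ y ∈ tsupport g, ∀ x ∈ tsupport f, ∃ U V : Set Z, IsOpen U ∧ IsOpen V ∧ x ∈ U ∧ y ∈ V ∧
      ∀ φ ψ : C(Z, ℂ), HasCompactSupport φ → HasCompactSupport ψ → tsupport φ ⊆ U →
        tsupport ψ ⊆ V → Q ψ φ) : Q g f := by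
  have step (y : Z) (hy : y ∈ tsupport g) : ∃ V : Set Z, IsOpen V ∧ y ∈ V ∧
      ∀ ψ : C(Z, ℂ), HasCompactSupport ψ → tsupport ψ ⊆ V → Q ψ f := by
    choose! U V hUo hVo hxU hyV hQ using h y hy
    obtain ⟨n, x, p, hx, rfl, hp⟩ := exists_sum_eq_of_cover hf fun x hx => ⟨hUo x hx, hxU x hx⟩
    refine ⟨⋂ i, V (x i), isOpen_iInter_of_finite fun i => hVo _ (hx i),
      Set.mem_iInter.2 fun i => hyV _ (hx i), fun ψ hψ hψV => ?_⟩
    exact Finset.sum_induction p (Q ψ) (add_right ψ) (zero_right ψ hψ) fun i _ =>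
      hQ _ (hx i) _ _ (hp i).1 hψ (hp i).2 (hψV.trans (Set.iInter_subset _ i))
  choose! V hVo hyV hQ using step
  obtain ⟨n, y, p, hy, rfl, hp⟩ := exists_sum_eq_of_cover hg fun y hy => ⟨hVo y hy, hyV y hy⟩
  exact Finset.sum_induction p (Q · f) (fun a b => add_left a b f) (zero_left f hf) fun i _ =>
    hQ _ (hy i) _ (hp i).1 (hp i).2

end Supports

section Modules

variable {π : C₀(X, ℂ) → H →L[ℂ] H}

lemma onePointRestrict_apply (f : C(OnePoint X, ℂ)) (x : X) :
    onePointRestrict f x = f x - f OnePoint.infty := rfl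

lemma IsStarRep.map_zero (hπ : IsStarRep π) : π 0 = 0 := by
  simpa using hπ.map_smul 0 0

lemma IsStarRep.map_sub (hπ : IsStarRep π) (φ ψ : C₀(X, ℂ)) : π (φ - ψ) = π φ - π ψ := by
  rw [eq_sub_iff_add_eq, ← hπ.map_add, sub_add_cancel]

lemma IsStarRep.map_mul' (hπ : IsStarRep π) (φ ψ : C₀(X, ℂ)) : π (φ * ψ) = π φ * π ψ :=
  hπ.map_mul φ ψ

/-- The representation of `C(X⁺)` on an `X`-module, as a ⋆-homomorphism. -/
def IsStarRep.plusHom (hπ : IsStarRep π) : C(OnePoint X, ℂ) →⋆ₐ[ℂ] (H →L[ℂ] H) where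
  toFun := onePointAct π
  map_one' := by
    have : onePointRestrict (1 : C(OnePoint X, ℂ)) = 0 := by ext; simp [onePointRestrict_apply]
    simp [onePointAct, this, hπ.map_zero]
  map_zero' := by
    have : onePointRestrict (0 : C(OnePoint X, ℂ)) = 0 := by ext; simp [onePointRestrict_apply]
    simp [onePointAct, this, hπ.map_zero]
  map_add' f g := by
    have : onePointRestrict (f + g) = onePointRestrict f + onePointRestrict g := by
      ext; simp [onePointRestrict_apply]; ring
    simp only [onePointAct, this, hπ.map_add, ContinuousMap.add_apply, add_smul]
    abel
  map_mul' f g := by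
    have : onePointRestrict (f * g) = onePointRestrict f * onePointRestrict g +
        (f OnePoint.infty • onePointRestrict g + g OnePoint.infty • onePointRestrict f) := by
      ext; simp [onePointRestrict_apply]; ring
    simp only [onePointAct, this, hπ.map_add, hπ.map_smul, hπ.map_mul, ContinuousMap.mul_apply,
      ← ContinuousLinearMap.mul_def, mul_add, add_mul, smul_mul_assoc, mul_smul_comm, one_mul,
      mul_one]
    module
  commutes' a := by
    have : onePointRestrict (algebraMap ℂ C(OnePoint X, ℂ) a) = 0 := by
      ext; simp [onePointRestrict_apply]
    rw [onePointAct, this, hπ.map_zero, add_zero, Algebra.algebraMap_eq_smul_one (A := H →L[ℂ] H)]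
    simp [Algebra.algebraMap_eq_smul_one]
  map_star' f := by
    have : onePointRestrict (star f) = star (onePointRestrict f) := by
      ext; simp [onePointRestrict_apply]
    simp only [onePointAct, this, ← hπ.map_star, star_add, star_smul, star_one,
      ← ContinuousLinearMap.star_eq_adjoint, ContinuousMap.star_apply]

lemma IsStarRep.plusHom_apply (hπ : IsStarRep π) (f : C(OnePoint X, ℂ)) :
    hπ.plusHom f = onePointAct π f := rfl

/-- Extension by zero of a function vanishing at infinity to the one-point compactification. -/
def extendPlus [T2Space X] (φ : C₀(X, ℂ)) : C(OnePoint X, ℂ) :=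
  OnePoint.continuousMapMk φ.toContinuousMap 0 <| by
    rw [Filter.coclosedCompact_eq_cocompact]
    exact φ.zero_at_infty'

@[simp] lemma extendPlus_infty [T2Space X] (φ : C₀(X, ℂ)) : extendPlus φ OnePoint.infty = 0 := rfl

@[simp] lemma extendPlus_coe [T2Space X] (φ : C₀(X, ℂ)) (x : X) : extendPlus φ x = φ x := rfl

lemma IsStarRep.plusHom_extendPlus [T2Space X] (hπ : IsStarRep π) (φ : C₀(X, ℂ)) :
    hπ.plusHom (extendPlus φ) = π φ := by
  have : onePointRestrict (extendPlus φ) = φ := by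
    ext x
    simp [onePointRestrict_apply]
  simp [IsStarRep.plusHom_apply, onePointAct, this]

end Modules

section Contractions

variable {E : Type*} [NormedAddCommGroup E] [NormedSpace ℂ E]

lemma tendsto_apply_zero_of_mem_closure {A : ℕ → E →L[ℂ] E} (hA : ∀ n, ‖A n‖ ≤ 1) {D : Set E}
    (hD : ∀ v ∈ D, Tendsto (fun n => A n v) atTop (𝓝 0)) {v : E} (hv : v ∈ closure D) :
    Tendsto (fun n => A n v) atTop (𝓝 0) := by
  rw [Metric.tendsto_atTop']
  intro ε hε
  obtain ⟨w, hw, hvw⟩ := Metric.mem_closure_iff.1 hv (ε / 2) (half_pos hε)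
  obtain ⟨N, hN⟩ := Metric.tendsto_atTop'.1 (hD w hw) (ε / 2) (half_pos hε)
  refine ⟨N, fun n hn => ?_⟩
  have h1 := hN n hn
  rw [dist_zero_right] at h1 ⊢
  have h2 : ‖A n (v - w)‖ ≤ ‖v - w‖ := (A n).le_of_opNorm_le (hA n) _ |>.trans_eq (one_mul _)
  rw [dist_eq_norm] at hvw
  calc ‖A n v‖ = ‖A n (v - w) + A n w‖ := by rw [← map_add, sub_add_cancel]
    _ ≤ ‖A n (v - w)‖ + ‖A n w‖ := norm_add_le _ _
    _ < ε := by linarith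

lemma eventually_forall_norm_apply_le {A : ℕ → E →L[ℂ] E} (hA : ∀ n, ‖A n‖ ≤ 1) {C : Set E}
    (hC : IsCompact C) (h : ∀ v ∈ C, Tendsto (fun n => A n v) atTop (𝓝 0)) {ε : ℝ} (hε : 0 < ε) :
    ∀ᶠ n in atTop, ∀ v ∈ C, ‖A n v‖ ≤ ε := by
  refine hC.induction_on (p := fun s => ∀ᶠ n in atTop, ∀ v ∈ s, ‖A n v‖ ≤ ε) (by simp)
    (fun s t hst ht => ht.mono fun n hn v hv => hn v (hst hv))
    (fun s t hs ht => (hs.and ht).mono fun n hn v hv => hv.elim (hn.1 v) (hn.2 v))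
    fun w hw => ⟨C ∩ Metric.ball w (ε / 2), ?_, ?_⟩
  · exact inter_mem self_mem_nhdsWithin
      (mem_nhdsWithin_of_mem_nhds (Metric.ball_mem_nhds w (half_pos hε)))
  · filter_upwards [Metric.tendsto_nhds.1 (h w hw) (ε / 2) (half_pos hε)] with n hn v hv
    rw [dist_zero_right] at hn
    have h2 : ‖A n (v - w)‖ ≤ ‖v - w‖ := (A n).le_of_opNorm_le (hA n) _ |>.trans_eq (one_mul _)
    have h3 := hv.2
    rw [Metric.mem_ball, dist_eq_norm] at h3
    calc ‖A n v‖ = ‖A n (v - w) + A n w‖ := by rw [← map_add, sub_add_cancel]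
      _ ≤ ‖A n (v - w)‖ + ‖A n w‖ := norm_add_le _ _
      _ ≤ ε := by linarith

end Contractions

section Cutoffs

variable {π : C₀(X, ℂ) → H →L[ℂ] H}

/-- A sequence of compactly supported cutoff functions, eventually equal to `1` near any given
compact set. -/
structure IsCutoffSeq (e : ℕ → C₀(X, ℂ)) : Prop where
  hasCompactSupport : ∀ n, HasCompactSupport (e n)
  norm_le : ∀ n x, ‖e n x‖ ≤ 1
  norm_one_sub_le : ∀ n x, ‖1 - e n x‖ ≤ 1
  star_eq : ∀ n, star (e n) = e n
  eventually_eq_one : ∀ K : Set X, IsCompact K →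
    ∀ᶠ n in atTop, ∃ W, IsOpen W ∧ K ⊆ W ∧ ∀ x ∈ W, e n x = 1

lemma exists_isCutoffSeq [T2Space X] [LocallyCompactSpace X] [SecondCountableTopology X] :
    ∃ e : ℕ → C₀(X, ℂ), IsCutoffSeq e := by
  let K : CompactExhaustion X := default
  choose p hp1 _ hpc hp using fun n =>
    exists_continuous_one_zero_of_isCompact (K.isCompact n) isClosed_empty (Set.disjoint_empty _)
  have hpc' (n) : HasCompactSupport (complexify (p n)) :=
    (hpc n).comp_left (g := fun r : ℝ => (r : ℂ)) Complex.ofReal_zero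
  refine ⟨fun n => ⟨complexify (p n), (hpc' n).is_zero_at_infty⟩, hpc', fun n x => ?_,
    fun n x => ?_, fun n => ?_, fun C hC => ?_⟩
  · change ‖(p n x : ℂ)‖ ≤ 1
    rw [Complex.norm_real, Real.norm_eq_abs, abs_le]
    exact ⟨by linarith [(hp n x).1], (hp n x).2⟩
  · change ‖1 - (p n x : ℂ)‖ ≤ 1
    rw [← Complex.ofReal_one, ← Complex.ofReal_sub, Complex.norm_real, Real.norm_eq_abs, abs_le]
    exact ⟨by linarith [(hp n x).2], by linarith [(hp n x).1]⟩
  · ext x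
    exact Complex.conj_ofReal _
  · obtain ⟨m, hm⟩ := K.exists_superset_of_isCompact hC
    filter_upwards [eventually_gt_atTop m] with n hn
    refine ⟨interior (K n), isOpen_interior, hm.trans (K.subset_interior hn), fun x hx => ?_⟩
    change ((p n x : ℝ) : ℂ) = 1
    rw [hp1 n (interior_subset hx), Pi.one_apply, Complex.ofReal_one]

variable {e : ℕ → C₀(X, ℂ)}

lemma IsStarRep.star_cutoff (hπ : IsStarRep π) (he : IsCutoffSeq e) (n : ℕ) :
    star (π (e n)) = π (e n) := by
  rw [ContinuousLinearMap.star_eq_adjoint, hπ.map_star, he.star_eq]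

variable [T2Space X]

lemma IsStarRep.norm_le (hπ : IsStarRep π) {φ : C₀(X, ℂ)} {c : ℝ} (hc : 0 ≤ c)
    (h : ∀ x, ‖φ x‖ ≤ c) : ‖π φ‖ ≤ c := by
  rw [← hπ.plusHom_extendPlus]
  refine norm_map_le _ hc fun z => ?_
  induction z with
  | infty => simpa using hc
  | coe x => simpa using h x

lemma IsStarRep.norm_one_sub_le (hπ : IsStarRep π) {φ : C₀(X, ℂ)}
    (h : ∀ x, ‖1 - φ x‖ ≤ 1) : ‖1 - π φ‖ ≤ 1 := by
  rw [← hπ.plusHom_extendPlus, ← map_one hπ.plusHom, ← _root_.map_sub]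
  refine norm_map_le _ zero_le_one fun z => ?_
  induction z with
  | infty => simp
  | coe x => simpa using h x

lemma IsStarRep.tendsto_one_sub_cutoff (hπ : IsStarRep π) (he : IsCutoffSeq e) (v : H) :
    Tendsto (fun n => (1 - π (e n)) v) atTop (𝓝 0) := by
  refine tendsto_apply_zero_of_mem_closure (A := fun n => 1 - π (e n))
    (fun n => hπ.norm_one_sub_le (he.norm_one_sub_le n)) (fun w hw => ?_) (hπ.nondeg v)
  induction hw using Submodule.span_induction with
  | zero => simp
  | add a b _ _ ha hb => simpa only [_root_.map_add, add_zero] using ha.add hb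
  | smul c a _ ha => simpa using ha.const_smul c
  | mem w hw =>
    obtain ⟨⟨φ, w⟩, rfl⟩ := hw
    have h0 : Tendsto (fun n => π (φ - e n * φ)) atTop (𝓝 0) := by
      rw [Metric.tendsto_nhds]
      intro ε hε
      obtain ⟨K, hK, hφK⟩ := mem_cocompact.1
        (Metric.tendsto_nhds.1 φ.zero_at_infty' (ε / 2) (half_pos hε))
      filter_upwards [he.eventually_eq_one K hK] with n ⟨W, _, hKW, hW⟩
      rw [dist_zero_right]
      refine (hπ.norm_le (half_pos hε).le fun x => ?_).trans_lt (half_lt_self hε)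
      by_cases hx : x ∈ K
      · simp [hW x (hKW hx), (half_pos hε).le]
      · have h1 : ‖φ x‖ < ε / 2 := by simpa using hφK hx
        calc ‖(φ - e n * φ) x‖ = ‖1 - e n x‖ * ‖φ x‖ := by
              rw [← norm_mul, sub_mul, one_mul]; rfl
          _ ≤ 1 * ‖φ x‖ := by gcongr; exact he.norm_one_sub_le n x
          _ ≤ ε / 2 := by linarith
    have h1 := ((ContinuousLinearMap.apply ℂ H w).continuous.tendsto 0).comp h0
    refine (h1.congr fun n => ?_).trans (by simp)
    simp [hπ.map_sub, hπ.map_mul]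

lemma IsStarRep.tendsto_one_sub_cutoff_mul (hπ : IsStarRep π) (he : IsCutoffSeq e)
    {T : H →L[ℂ] H} (hT : IsCompactOperator T) :
    Tendsto (fun n => (1 - π (e n)) * T) atTop (𝓝 0) := by
  rw [Metric.tendsto_nhds]
  intro ε hε
  have hC := hT.isCompact_closure_image_closedBall 1
  filter_upwards [eventually_forall_norm_apply_le (A := fun n => 1 - π (e n))
    (fun n => hπ.norm_one_sub_le (he.norm_one_sub_le n)) hC
    (fun v _ => hπ.tendsto_one_sub_cutoff he v) (half_pos hε)] with n hn
  rw [dist_zero_right]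
  refine (ContinuousLinearMap.opNorm_le_of_unit_norm (𝕜 := ℂ) (half_pos hε).le
    fun x hx => ?_).trans_lt (half_lt_self hε)
  exact hn _ (subset_closure ⟨x, by simp [hx], rfl⟩)

lemma IsStarRep.tendsto_mul_one_sub_cutoff (hπ : IsStarRep π) (he : IsCutoffSeq e)
    {T : H →L[ℂ] H} (hT : IsCompactOperator T) :
    Tendsto (fun n => T * (1 - π (e n))) atTop (𝓝 0) := by
  have h1 : Tendsto (fun n => ‖(1 - π (e n)) * (star T * T)‖) atTop (𝓝 0) := by
    simpa using (hπ.tendsto_one_sub_cutoff_mul he (T := star T * T) (hT.clm_comp (star T))).norm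
  rw [tendsto_zero_iff_norm_tendsto_zero]
  have h2 : Tendsto (fun n => √‖(1 - π (e n)) * (star T * T)‖) atTop (𝓝 0) := by
    simpa using h1.sqrt
  refine squeeze_zero (fun n => norm_nonneg _) (fun n => Real.le_sqrt_of_sq_le ?_) h2
  rw [sq, ← CStarRing.norm_star_mul_self, star_mul, star_sub, star_one, hπ.star_cutoff he]
  calc _ = ‖(1 - π (e n)) * (star T * T) * (1 - π (e n))‖ := by simp only [mul_assoc]
    _ ≤ ‖(1 - π (e n)) * (star T * T)‖ * 1 := (norm_mul_le _ _).trans (by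
        gcongr; exact hπ.norm_one_sub_le (he.norm_one_sub_le n))
    _ = _ := mul_one _

lemma IsStarRep.eq_zero_of_cutoff (hπ : IsStarRep π) (he : IsCutoffSeq e) {A : H →L[ℂ] H}
    (h : ∀ m n, π (e m) * A * π (e n) = 0) : A = 0 := by
  have lim (v : H) : Tendsto (fun n => π (e n) v) atTop (𝓝 v) := by
    have := (tendsto_const_nhds (x := v)).sub (hπ.tendsto_one_sub_cutoff he v)
    simpa using this
  ext v
  have h1 (n : ℕ) : A (π (e n) v) = 0 :=
    tendsto_nhds_unique (lim _) <| tendsto_const_nhds.congr fun m => by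
      simpa using (DFunLike.congr_fun (h m n) v).symm
  exact tendsto_nhds_unique ((A.continuous.tendsto v).comp (lim v)) <|
    tendsto_const_nhds.congr fun m => (h1 m).symm

end Cutoffs

section SmallSupports

variable {π : C₀(X, ℂ) → H →L[ℂ] H} [T2Space X] [LocallyCompactSpace X]

lemma IsStarRep.plusHom_mul_mul_eq_zero (hπ : IsStarRep π) {T : H →L[ℂ] H}
    {f g : C(OnePoint X, ℂ)}
    (h : ∀ y ∈ tsupport g, ∀ x ∈ tsupport f, (y, x) ∉ opSupportPlus π T) :
    hπ.plusHom g * T * hπ.plusHom f = 0 := by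
  refine rel_of_forall_exists_isOpen (Q := fun g f => hπ.plusHom g * T * hπ.plusHom f = 0)
    (fun f _ => by simp) (fun g _ => by simp) (fun g₁ g₂ f h₁ h₂ => ?_) (fun g f₁ f₂ h₁ h₂ => ?_)
    (HasCompactSupport.of_compactSpace f) (HasCompactSupport.of_compactSpace g) fun y hy x hx => ?_
  · rw [_root_.map_add, add_mul, add_mul, h₁, h₂, add_zero]
  · rw [_root_.map_add, mul_add, h₁, h₂, add_zero]
  · have := h y hy x hx
    simp only [opSupportPlus, Set.mem_ofPred_eq] at this
    push Not at this
    obtain ⟨U, V, hU, hV, hxU, hyV, hz⟩ := this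
    exact ⟨U, V, hU, hV, hxU, hyV, fun φ ψ _ _ hφ hψ =>
      (mul_assoc _ _ _).trans (hz φ ψ hφ hψ)⟩

lemma IsStarRep.mul_mul_eq_zero (hπ : IsStarRep π) {T : H →L[ℂ] H} {φ ψ : C₀(X, ℂ)}
    (hφ : HasCompactSupport φ) (hψ : HasCompactSupport ψ)
    (h : ∀ y ∈ tsupport ψ, ∀ x ∈ tsupport φ, (y, x) ∉ opSupport π T) :
    π ψ * T * π φ = 0 := by
  have toC₀ (f : C(X, ℂ)) (hf : HasCompactSupport f) : ∃ f' : C₀(X, ℂ), ⇑f' = f :=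
    ⟨⟨f, hf.is_zero_at_infty⟩, rfl⟩
  have key := rel_of_forall_exists_isOpen (f := φ.toContinuousMap) (g := ψ.toContinuousMap)
    (Q := fun g f => ∃ g' f' : C₀(X, ℂ), ⇑g' = g ∧ ⇑f' = f ∧ π g' * T * π f' = 0)
    (fun f hf => ?_) (fun g hg => ?_) ?_ ?_ hφ hψ fun y hy x hx => ?_
  · obtain ⟨g', f', hg', hf', h0⟩ := key
    rwa [DFunLike.coe_injective (hg' : ⇑g' = ⇑ψ), DFunLike.coe_injective (hf' : ⇑f' = ⇑φ)] at h0
  · obtain ⟨f', hf'⟩ := toC₀ f hf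
    exact ⟨0, f', rfl, hf', by simp [hπ.map_zero]⟩
  · obtain ⟨g', hg'⟩ := toC₀ g hg
    exact ⟨g', 0, hg', rfl, by simp [hπ.map_zero]⟩
  · rintro g₁ g₂ f ⟨a, b, ha, hb, h₁⟩ ⟨c, d, hc, hd, h₂⟩
    obtain rfl : b = d := DFunLike.coe_injective (hb.trans hd.symm)
    refine ⟨a + c, b, ?_, hb, ?_⟩
    · rw [ZeroAtInftyContinuousMap.coe_add, ContinuousMap.coe_add, ha, hc]
    · rw [hπ.map_add, add_mul, add_mul, h₁, h₂, add_zero]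
  · rintro g f₁ f₂ ⟨a, b, ha, hb, h₁⟩ ⟨c, d, hc, hd, h₂⟩
    obtain rfl : a = c := DFunLike.coe_injective (ha.trans hc.symm)
    refine ⟨a, b + d, ha, ?_, ?_⟩
    · rw [ZeroAtInftyContinuousMap.coe_add, ContinuousMap.coe_add, hb, hd]
    · rw [hπ.map_add, mul_add, h₁, h₂, add_zero]
  · have := h y hy x hx
    simp only [opSupport, Set.mem_ofPred_eq] at this
    push Not at this
    obtain ⟨U, V, hU, hV, hxU, hyV, hz⟩ := this
    refine ⟨U, V, hU, hV, hxU, hyV, fun f g hf hg hfU hgV => ?_⟩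
    obtain ⟨f', hf'⟩ := toC₀ f hf
    obtain ⟨g', hg'⟩ := toC₀ g hg
    exact ⟨g', f', hg', hf', (mul_assoc _ _ _).trans
      (hz f' g' (by rwa [hf']) (by rwa [hg']))⟩

/-- A cutoff function equal to `1` near `K` acts as a two-sided unit on operators supported in
`K × K`. -/
lemma IsStarRep.mul_mul_eq_self (hπ : IsStarRep π) {e : ℕ → C₀(X, ℂ)} (he : IsCutoffSeq e)
    {T : H →L[ℂ] H} {K : Set X} (hT : opSupport π T ⊆ K ×ˢ K) {φ : C₀(X, ℂ)} {W : Set X}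
    (hW : IsOpen W) (hKW : K ⊆ W) (hφ : ∀ x ∈ W, φ x = 1) : π φ * T * π φ = T := by
  have hsupp (ψ : C₀(X, ℂ)) : ∀ x ∈ tsupport (ψ - ψ * φ), x ∉ K := by
    intro x hx hxK
    have : tsupport (ψ - ψ * φ) ⊆ Wᶜ :=
      closure_minimal (fun z hz hzW => hz (by simp [hφ z hzW])) hW.isClosed_compl
    exact this hx (hKW hxK)
  have hcs (n : ℕ) : HasCompactSupport (e n - e n * φ) := by
    have : ⇑(e n - e n * φ) = e n * (1 - ⇑φ) := by
      ext x
      simp [mul_sub]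
    rw [this]
    exact (he.hasCompactSupport n).mul_right
  have left : (1 - π φ) * T = 0 := hπ.eq_zero_of_cutoff he fun m n => by
    have := hπ.mul_mul_eq_zero (T := T) (he.hasCompactSupport n) (hcs m)
      fun y hy x _ hyx => hsupp _ y hy (hT hyx).1
    rw [hπ.map_sub, hπ.map_mul'] at this
    rw [← this]
    noncomm_ring
  have right : T * (1 - π φ) = 0 := hπ.eq_zero_of_cutoff he fun m n => by
    have := hπ.mul_mul_eq_zero (T := T) (hcs n) (he.hasCompactSupport m)
      fun y _ x hx hyx => hsupp _ x hx (hT hyx).2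
    rw [mul_comm (e n) φ, hπ.map_sub, hπ.map_mul'] at this
    rw [← this]
    noncomm_ring
  rw [sub_mul, one_mul, sub_eq_zero] at left
  rw [mul_sub, mul_one, sub_eq_zero] at right
  rw [← left, ← right]

lemma IsStarRep.tendsto_commutator_of_mem_Icc (hπ : IsStarRep π) {T : ℝ → H →L[ℂ] H}
    (hb : OpBdd T) (hs : SmallSuppPlus π T) {G : C(OnePoint X, ℝ)}
    (hG : ∀ y, G y ∈ Set.Icc (0 : ℝ) 1) :
    Tendsto (fun t => ⁅hπ.plusHom (complexify G), T t⁆) atTop (𝓝 0) := by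
  obtain ⟨C, hC⟩ := hb
  rw [Metric.tendsto_nhds]
  intro ε hε
  obtain ⟨N, hN⟩ := exists_nat_gt (972 * C ^ 2 / ε ^ 2)
  have hN0 : (0 : ℝ) < N := lt_of_le_of_lt (by positivity) hN
  obtain ⟨t₀, ht₀, hU⟩ := hs {p | |N * G p.1 - N * G p.2| < 1}
    (isOpen_lt (by fun_prop) continuous_const) (by simp)
  filter_upwards [eventually_gt_atTop t₀] with t ht
  rw [dist_zero_right]
  have htsupp (i : ℕ) : ∀ y ∈ tsupport (complexify (tent G N i)), |N * G y - i| ≤ 1 := by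
    have : IsClosed {y | |N * G y - i| ≤ 1} := isClosed_le (by fun_prop) continuous_const
    exact closure_minimal (fun y hy => abs_le_of_tent_ne_zero fun h => hy (by simp [h])) this
  have := sq_norm_commutator_le hπ.plusHom hG (N := N) (by exact_mod_cast hN0) (T t)
    fun i j hij => hπ.plusHom_mul_mul_eq_zero fun y hy x hx hyx => by
      have h1 : |N * G y - N * G x| < 1 := hU t ht hyx
      have h2 := htsupp i y hy
      have h3 := htsupp j x hx
      have h4 : 3 ≤ |(i : ℝ) - j| := by
        have : (2 : ℤ) < |(i : ℤ) - j| := by exact_mod_cast hij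
        have : (3 : ℤ) ≤ |(i : ℤ) - j| := by omega
        exact_mod_cast this
      grind
  have hTC : ‖T t‖ ^ 2 ≤ C ^ 2 := by gcongr; exact hC t (by linarith)
  refine lt_of_pow_lt_pow_left₀ 2 hε.le (this.trans_lt ?_)
  rw [div_lt_iff₀ (by positivity)] at hN ⊢
  linarith

lemma IsStarRep.tendsto_commutator_complexify (hπ : IsStarRep π) {T : ℝ → H →L[ℂ] H}
    (hb : OpBdd T) (hs : SmallSuppPlus π T) (F : C(OnePoint X, ℝ)) :
    Tendsto (fun t => ⁅hπ.plusHom (complexify F), T t⁆) atTop (𝓝 0) := by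
  set R : ℝ := ‖F‖ + 1 with hR
  have hR0 : 0 < R := by positivity
  let G : C(OnePoint X, ℝ) := ⟨fun y => (F y + R) / (2 * R), by fun_prop⟩
  have hG (y) : G y ∈ Set.Icc (0 : ℝ) 1 := by
    have := abs_le.1 (F.norm_coe_le_norm y)
    change (F y + R) / (2 * R) ∈ _
    rw [Set.mem_Icc, le_div_iff₀ (by positivity), div_le_iff₀ (by positivity)]
    constructor <;> linarith
  have hF : complexify F = (2 * R : ℂ) • complexify G - algebraMap ℂ _ (R : ℂ) := by
    ext y
    have : F y = 2 * R * G y - R := by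
      change F y = 2 * R * ((F y + R) / (2 * R)) - R
      field_simp
      ring
    simp [this, Algebra.algebraMap_eq_smul_one]
  have := (hπ.tendsto_commutator_of_mem_Icc hb hs hG).const_smul (2 * R : ℂ)
  rw [smul_zero] at this
  refine this.congr fun t => ?_
  rw [hF, _root_.map_sub, _root_.map_smul, AlgHomClass.commutes, Ring.lie_def, Ring.lie_def,
    sub_mul, mul_sub, Algebra.commutes, smul_mul_assoc, mul_smul_comm, smul_sub]
  abel

/-- Operators whose supports shrink to the diagonal asymptotically commute with functions. -/
lemma IsStarRep.commDecay_of_smallSuppPlus (hπ : IsStarRep π) {T : ℝ → H →L[ℂ] H}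
    (hb : OpBdd T) (hs : SmallSuppPlus π T) : CommDecay π T := by
  intro φ
  let re : C(OnePoint X, ℝ) := ⟨fun y => (extendPlus φ y).re, by fun_prop⟩
  let im : C(OnePoint X, ℝ) := ⟨fun y => (extendPlus φ y).im, by fun_prop⟩
  have hφ : extendPlus φ = complexify re + Complex.I • complexify im := by
    ext y
    simp only [ContinuousMap.add_apply, ContinuousMap.smul_apply, complexify_apply, smul_eq_mul]
    rw [mul_comm]
    exact (Complex.re_add_im _).symm
  have := (hπ.tendsto_commutator_complexify hb hs re).add
    ((hπ.tendsto_commutator_complexify hb hs im).const_smul Complex.I)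
  rw [smul_zero, add_zero] at this
  refine (tendsto_zero_iff_norm_tendsto_zero.1 this).congr fun t => ?_
  rw [← hπ.plusHom_extendPlus, hφ, _root_.map_add, _root_.map_smul, Ring.lie_def, Ring.lie_def,
    ← ContinuousLinearMap.mul_def, ← ContinuousLinearMap.mul_def, add_mul, mul_add,
    smul_mul_assoc, mul_smul_comm, smul_sub]
  congr 1
  abel

end SmallSupports

section UniformClosure

omit [CompleteSpace H] in
lemma unifClosure_subset_of_subset {A B : Set (ℝ → H →L[ℂ] H)} (h : A ⊆ UnifClosure B) :
    UnifClosure A ⊆ UnifClosure B := by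
  intro T hT ε hε
  obtain ⟨S, hS, hTS⟩ := hT (ε / 2) (half_pos hε)
  obtain ⟨R, hR, hSR⟩ := h hS (ε / 2) (half_pos hε)
  refine ⟨R, hR, fun t ht => ?_⟩
  calc ‖T t - R t‖ ≤ ‖T t - S t‖ + ‖S t - R t‖ := norm_sub_le_norm_sub_add_norm_sub _ _ _
    _ ≤ ε := by linarith [hTS t ht, hSR t ht]

end UniformClosure

section Compression

variable {π : C₀(X, ℂ) → H →L[ℂ] H}

lemma IsStarRep.opSupport_compression_subset (hπ : IsStarRep π) (φ : C₀(X, ℂ)) (T : H →L[ℂ] H) :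
    opSupport π (π φ * T * π φ) ⊆ tsupport φ ×ˢ tsupport φ := by
  have hmul {ψ : C₀(X, ℂ)} (hψ : tsupport ψ ⊆ (tsupport φ)ᶜ) : ψ * φ = 0 := by
    ext x
    by_cases hx : x ∈ tsupport φ
    · have : ψ x = 0 := image_eq_zero_of_notMem_tsupport fun h => hψ h hx
      simp [this]
    · simp [image_eq_zero_of_notMem_tsupport hx]
  rintro ⟨y, x⟩ h
  by_contra hyx
  rw [Set.mem_prod, not_and_or] at hyx
  rcases hyx with hy | hx
  · obtain ⟨f, g, -, hg, h0⟩ := h Set.univ (tsupport φ)ᶜ isOpen_univ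
      (isClosed_tsupport _).isOpen_compl trivial hy
    refine h0 ?_
    calc _ = π g * π φ * (T * π φ * π f) := by
          simp only [← ContinuousLinearMap.mul_def, mul_assoc]
      _ = 0 := by rw [← hπ.map_mul', hmul hg, hπ.map_zero, zero_mul]
  · obtain ⟨f, g, hf, -, h0⟩ := h (tsupport φ)ᶜ Set.univ
      (isClosed_tsupport _).isOpen_compl isOpen_univ hx trivial
    refine h0 ?_
    calc _ = π g * π φ * T * (π φ * π f) := by
          simp only [← ContinuousLinearMap.mul_def, mul_assoc]
      _ = 0 := by rw [← hπ.map_mul' φ f, mul_comm φ f, hmul hf, hπ.map_zero, mul_zero]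

lemma IsStarRep.commDecay_compression (hπ : IsStarRep π) {T : ℝ → H →L[ℂ] H}
    (hT : CommDecay π T) {χ : C₀(X, ℂ)} (hχ : ‖π χ‖ ≤ 1) :
    CommDecay π fun t => π χ * T t * π χ := by
  intro φ
  refine squeeze_zero (fun _ => norm_nonneg _) (fun t => ?_) (hT φ)
  have h : π φ * π χ = π χ * π φ := by rw [← hπ.map_mul', ← hπ.map_mul', mul_comm]
  have : (π φ).comp (π χ * T t * π χ) - (π χ * T t * π χ).comp (π φ)
      = π χ * ((π φ).comp (T t) - (T t).comp (π φ)) * π χ := by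
    simp only [← ContinuousLinearMap.mul_def]
    calc _ = (π φ * π χ) * T t * π χ - π χ * T t * (π χ * π φ) := by noncomm_ring
      _ = (π χ * π φ) * T t * π χ - π χ * T t * (π φ * π χ) := by rw [h]
      _ = _ := by noncomm_ring
  rw [this]
  calc _ ≤ 1 * ‖(π φ).comp (T t) - (T t).comp (π φ)‖ * 1 := norm_mul₃_le.trans (by gcongr)
    _ = _ := by ring

/-- Compressing by a large cutoff function moves a compact set of compact operators only
slightly. -/
lemma IsStarRep.eventually_forall_norm_sub_compression_le [T2Space X] (hπ : IsStarRep π)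
    {e : ℕ → C₀(X, ℂ)} (he : IsCutoffSeq e) {C : Set (H →L[ℂ] H)} (hC : IsCompact C)
    (hCc : ∀ T ∈ C, IsCompactOperator T) {ε : ℝ} (hε : 0 < ε) :
    ∀ᶠ n in atTop, ∀ T ∈ C, ‖T - π (e n) * T * π (e n)‖ ≤ ε := by
  have hle (n : ℕ) : ‖1 - π (e n)‖ ≤ 1 := hπ.norm_one_sub_le (he.norm_one_sub_le n)
  have h1 := eventually_forall_norm_apply_le
    (A := fun n => ContinuousLinearMap.mul ℂ (H →L[ℂ] H) (1 - π (e n)))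
    (fun n => (ContinuousLinearMap.opNorm_mul_apply_le ..).trans (hle n)) hC
    (fun T hT => hπ.tendsto_one_sub_cutoff_mul he (hCc T hT)) (half_pos hε)
  have h2 := eventually_forall_norm_apply_le
    (A := fun n => (ContinuousLinearMap.mul ℂ (H →L[ℂ] H)).flip (1 - π (e n)))
    (fun n => ContinuousLinearMap.opNorm_le_bound _ zero_le_one fun T => by
      rw [one_mul, ContinuousLinearMap.flip_apply, ContinuousLinearMap.mul_apply']
      exact (norm_mul_le _ _).trans (mul_le_of_le_one_right (norm_nonneg _) (hle n))) hC
    (fun T hT => hπ.tendsto_mul_one_sub_cutoff he (hCc T hT)) (half_pos hε)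
  filter_upwards [h1, h2] with n hn1 hn2 T hT
  have e1 : ‖(1 - π (e n)) * T‖ ≤ ε / 2 := hn1 T hT
  have e2 : ‖T * (1 - π (e n))‖ ≤ ε / 2 := hn2 T hT
  have e3 : ‖π (e n)‖ ≤ 1 := hπ.norm_le zero_le_one (he.norm_le n)
  calc ‖T - π (e n) * T * π (e n)‖
      = ‖(1 - π (e n)) * T + π (e n) * (T * (1 - π (e n)))‖ := by congr 1; noncomm_ring
    _ ≤ ε / 2 + 1 * (ε / 2) := (norm_add_le _ _).trans <| add_le_add e1 <|
        (norm_mul_le _ _).trans (mul_le_mul e3 e2 (norm_nonneg _) zero_le_one)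
    _ = ε := by ring

lemma IsStarRep.rlalgEv_subset [T2Space X] [LocallyCompactSpace X] [SecondCountableTopology X]
    (hπ : IsStarRep π) : RLalgEv π ⊆ UnifClosure (RLalg π) := by
  rintro T ⟨hb, hcont, hcpt, ⟨K, t₀, hK, ht₀, hsupp⟩, hsmall⟩ ε hε
  obtain ⟨e, he⟩ := exists_isCutoffSeq (X := X)
  have hC : IsCompact (T '' Set.Icc 1 t₀) :=
    isCompact_Icc.image_of_continuousOn (hcont.mono Set.Icc_subset_Ici_self)
  obtain ⟨n, hn, W, hW, hKW, hW1⟩ := ((hπ.eventually_forall_norm_sub_compression_le he hC (by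
    rintro _ ⟨t, ht, rfl⟩
    exact hcpt t ht.1) hε).and (he.eventually_eq_one K hK)).exists
  have hle : ‖π (e n)‖ ≤ 1 := hπ.norm_le zero_le_one (he.norm_le n)
  refine ⟨fun t => π (e n) * T t * π (e n), ⟨?_, ?_, fun t ht => ?_, ?_, ?_⟩, fun t ht => ?_⟩
  · obtain ⟨C, hC⟩ := hb
    refine ⟨1 * C * 1, fun t ht => ?_⟩
    have hCt := hC t ht
    have : 0 ≤ C := (norm_nonneg _).trans hCt
    exact norm_mul₃_le.trans (by gcongr)
  · exact (continuousOn_const.mul hcont).mul continuousOn_const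
  · exact ((hcpt t ht).clm_comp (π (e n))).comp_clm (π (e n))
  · exact ⟨tsupport (e n), he.hasCompactSupport n, fun t _ =>
      hπ.opSupport_compression_subset _ _⟩
  · exact hπ.commDecay_compression (hπ.commDecay_of_smallSuppPlus hb hsmall) hle
  · rcases le_total t t₀ with h | h
    · exact hn _ ⟨t, ⟨ht, h⟩, rfl⟩
    · change ‖T t - π (e n) * T t * π (e n)‖ ≤ ε
      rw [hπ.mul_mul_eq_self he (hsupp t h) hW hKW hW1, sub_self, norm_zero]
      exact hε.le

end Compression

section Diagonal

lemma secondCountableTopology_onePoint [T2Space X] [LocallyCompactSpace X]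
    [SecondCountableTopology X] : SecondCountableTopology (OnePoint X) := by
  let K : CompactExhaustion X := default
  let B : Set (Set (OnePoint X)) := (fun s => ((↑) '' s : Set (OnePoint X))) ''
    TopologicalSpace.countableBasis X ∪ Set.range fun n => ((↑) '' (K n) : Set (OnePoint X))ᶜ
  have hB : B.Countable :=
    ((TopologicalSpace.countable_countableBasis X).image _).union (Set.countable_range _)
  refine (TopologicalSpace.isTopologicalBasis_of_isOpen_of_nhds (s := B) ?_ ?_)
    |>.secondCountableTopology hB
  · rintro _ (⟨s, hs, rfl⟩ | ⟨n, rfl⟩)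
    · exact OnePoint.isOpen_image_coe.2 (TopologicalSpace.isOpen_of_mem_countableBasis hs)
    · exact OnePoint.isOpen_compl_image_coe.2 ⟨(K.isCompact n).isClosed, K.isCompact n⟩
  · intro a u ha hu
    induction a with
    | infty =>
      obtain ⟨-, hc⟩ := (OnePoint.isOpen_iff_of_mem ha).1 hu
      obtain ⟨n, hn⟩ := K.exists_superset_of_isCompact hc
      refine ⟨_, Or.inr ⟨n, rfl⟩, by simp, fun z hz => ?_⟩
      induction z with
      | infty => exact ha
      | coe x =>
        by_contra h
        exact hz ⟨x, hn h, rfl⟩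
    | coe x =>
      obtain ⟨s, hs, hxs, hsu⟩ :=
        (TopologicalSpace.isBasis_countableBasis X).exists_subset_of_mem_open
        (show x ∈ ((↑) : X → OnePoint X) ⁻¹' u from ha) (hu.preimage OnePoint.continuous_coe)
      exact ⟨_, Or.inl ⟨s, hs, rfl⟩, ⟨x, hxs, rfl⟩, Set.image_subset_iff.2 hsu⟩

/-- The diagonal of a compact metrizable space has a decreasing sequence of closed neighbourhoods
as a neighbourhood basis. -/
lemma exists_antitone_isClosed_nhdsSet_diagonal {Y : Type*} [TopologicalSpace Y] [CompactSpace Y]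
    [T2Space Y] [SecondCountableTopology Y] :
    ∃ S : ℕ → Set (Y × Y), Antitone S ∧ (∀ n, IsClosed (S n)) ∧
      (∀ n, S n ∈ 𝓝ˢ (Set.diagonal Y)) ∧ ∀ U ∈ 𝓝ˢ (Set.diagonal Y), ∃ n, S n ⊆ U := by
  let := TopologicalSpace.metrizableSpaceMetric Y
  rw [nhdsSet_diagonal_eq_uniformity]
  refine ⟨fun n => {p | dist p.1 p.2 ≤ 1 / ((n : ℝ) + 1)}, fun m n hmn p hp => ?_, fun n => ?_,
    fun n => Metric.mem_uniformity_dist.2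
    ⟨1 / ((n : ℝ) + 1), Nat.one_div_pos_of_nat, fun _ _ h => le_of_lt h⟩, fun U hU => ?_⟩
  · exact (show dist p.1 p.2 ≤ 1 / ((n : ℝ) + 1) from hp).trans (Nat.one_div_le_one_div hmn)
  · exact isClosed_le continuous_dist continuous_const
  · obtain ⟨ε, hε, h⟩ := Metric.mem_uniformity_dist.1 hU
    obtain ⟨n, hn⟩ := exists_nat_one_div_lt hε
    exact ⟨n, fun p hp => h (lt_of_le_of_lt hp hn)⟩

/-- A compact Hausdorff space has arbitrarily fine finite quadratic partitions of unity. -/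
lemma exists_sum_mul_self_eq_one {Y : Type*} [TopologicalSpace Y] [CompactSpace Y]
    [T2Space Y] {U : Set (Y × Y)} (hU : U ∈ 𝓝ˢ (Set.diagonal Y)) :
    ∃ (n : ℕ) (χ : Fin n → C(Y, ℂ)), ∑ i, χ i * χ i = 1 ∧
      ∀ i y x, χ i y ≠ 0 → χ i x ≠ 0 → (y, x) ∈ U := by
  have hloc (y : Y) : ∃ V : Set Y, IsOpen V ∧ y ∈ V ∧ V ×ˢ V ⊆ U :=
    have ⟨V, W, hV, hyV, hW, hyW, h⟩ :=
      mem_nhds_prod_iff'.1 (mem_nhdsSet_iff_forall.1 hU (y, y) rfl)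
    ⟨V ∩ W, hV.inter hW, ⟨hyV, hyW⟩, fun p hp => h ⟨hp.1.1, hp.2.2⟩⟩
  choose V hVo hyV hVU using hloc
  obtain ⟨s, hs⟩ := isCompact_univ.elim_finite_subcover V hVo fun y _ =>
    Set.mem_iUnion.2 ⟨y, hyV y⟩
  obtain ⟨p, hp, hp1, hp0, -⟩ := exists_continuous_sum_one_of_isOpen_isCompact
    (s := fun i => V (s.equivFin.symm i)) (fun i => hVo _) isCompact_univ (by
      intro z hz
      obtain ⟨y, hy, hzy⟩ := Set.mem_iUnion₂.1 (hs hz)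
      exact Set.mem_iUnion.2 ⟨s.equivFin ⟨y, hy⟩, by simpa using hzy⟩)
  refine ⟨s.card, fun i => complexify ⟨fun y => √(p i y), by fun_prop⟩, ?_, fun i y x hy hx => ?_⟩
  · ext y
    have h1 : ∑ i, p i y = 1 := by simpa using hp1 (Set.mem_univ y)
    simp only [ContinuousMap.sum_apply, ContinuousMap.mul_apply, complexify_apply,
      ContinuousMap.coe_mk, ContinuousMap.one_apply]
    rw [← Complex.ofReal_one, ← h1, Complex.ofReal_sum]
    refine Finset.sum_congr rfl fun i _ => ?_
    rw [← Complex.ofReal_mul, Real.mul_self_sqrt (hp0 i y).1]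
  · have hmem {z : Y} (hz : complexify ⟨fun y => √(p i y), by fun_prop⟩ z ≠ 0) :
        z ∈ V (s.equivFin.symm i) :=
      hp i (subset_tsupport _ fun h => hz (by simp [h]))
    exact hVU _ ⟨hmem hy, hmem hx⟩

end Diagonal

section Localization

variable (π : C₀(X, ℂ) → H →L[ℂ] H)

/-- The subspace of operators on an `X`-module supported in a given set. -/
def suppIn (S : Set (X × X)) : Submodule ℂ (H →L[ℂ] H) where
  carrier := {T | opSupport π T ⊆ S}
  zero_mem' := fun p hp => by
    obtain ⟨φ, ψ, -, -, h⟩ := hp Set.univ Set.univ isOpen_univ isOpen_univ trivial trivial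
    simp at h
  add_mem' := fun {A B} hA hB p hp => by
    by_contra hpS
    have h1 : p ∉ opSupport π A := fun h => hpS (hA h)
    have h2 : p ∉ opSupport π B := fun h => hpS (hB h)
    simp only [opSupport, Set.mem_ofPred_eq] at h1 h2
    push Not at h1 h2
    obtain ⟨U, V, hU, hV, hxU, hyV, hAz⟩ := h1
    obtain ⟨U', V', hU', hV', hxU', hyV', hBz⟩ := h2
    obtain ⟨φ, ψ, hφ, hψ, h⟩ := hp (U ∩ U') (V ∩ V') (hU.inter hU') (hV.inter hV')
      ⟨hxU, hxU'⟩ ⟨hyV, hyV'⟩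
    rw [Set.subset_inter_iff] at hφ hψ
    refine h ?_
    rw [ContinuousLinearMap.add_comp, ContinuousLinearMap.comp_add, hAz φ ψ hφ.1 hψ.1,
      hBz φ ψ hφ.2 hψ.2, add_zero]
  smul_mem' := fun c A hA p hp => hA fun U V hU hV hxU hyV => by
    obtain ⟨φ, ψ, hφ, hψ, h⟩ := hp U V hU hV hxU hyV
    refine ⟨φ, ψ, hφ, hψ, fun h0 => h ?_⟩
    rw [ContinuousLinearMap.smul_comp, ContinuousLinearMap.comp_smul, h0, smul_zero]

/-- The subspace of operators on an `X`-module whose support in `X⁺ × X⁺` lies in a given set. -/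
def suppPlusIn (S : Set (OnePoint X × OnePoint X)) : Submodule ℂ (H →L[ℂ] H) where
  carrier := {T | opSupportPlus π T ⊆ S}
  zero_mem' := fun p hp => by
    obtain ⟨φ, ψ, -, -, h⟩ := hp Set.univ Set.univ isOpen_univ isOpen_univ trivial trivial
    simp at h
  add_mem' := fun {A B} hA hB p hp => by
    by_contra hpS
    have h1 : p ∉ opSupportPlus π A := fun h => hpS (hA h)
    have h2 : p ∉ opSupportPlus π B := fun h => hpS (hB h)
    simp only [opSupportPlus, Set.mem_ofPred_eq] at h1 h2
    push Not at h1 h2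
    obtain ⟨U, V, hU, hV, hxU, hyV, hAz⟩ := h1
    obtain ⟨U', V', hU', hV', hxU', hyV', hBz⟩ := h2
    obtain ⟨φ, ψ, hφ, hψ, h⟩ := hp (U ∩ U') (V ∩ V') (hU.inter hU') (hV.inter hV')
      ⟨hxU, hxU'⟩ ⟨hyV, hyV'⟩
    rw [Set.subset_inter_iff] at hφ hψ
    refine h ?_
    rw [ContinuousLinearMap.add_comp, ContinuousLinearMap.comp_add, hAz φ ψ hφ.1 hψ.1,
      hBz φ ψ hφ.2 hψ.2, add_zero]
  smul_mem' := fun c A hA p hp => hA fun U V hU hV hxU hyV => by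
    obtain ⟨φ, ψ, hφ, hψ, h⟩ := hp U V hU hV hxU hyV
    refine ⟨φ, ψ, hφ, hψ, fun h0 => h ?_⟩
    rw [ContinuousLinearMap.smul_comp, ContinuousLinearMap.comp_smul, h0, smul_zero]

variable {π}

/-- The cut-down `∑ i, χ i T χ i` of an operator along a family of functions on `X⁺`. -/
def IsStarRep.cutDown (hπ : IsStarRep π) {n : ℕ} (χ : Fin n → C(OnePoint X, ℂ)) (T : H →L[ℂ] H) :
    H →L[ℂ] H :=
  ∑ i, hπ.plusHom (χ i) * T * hπ.plusHom (χ i)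

lemma IsStarRep.continuous_cutDown (hπ : IsStarRep π) {n : ℕ} (χ : Fin n → C(OnePoint X, ℂ)) :
    Continuous (hπ.cutDown χ) := by
  unfold IsStarRep.cutDown
  fun_prop

lemma IsStarRep.cutDown_mem_compactOperator (hπ : IsStarRep π) {n : ℕ}
    (χ : Fin n → C(OnePoint X, ℂ)) {T : H →L[ℂ] H} (hT : IsCompactOperator T) :
    hπ.cutDown χ T ∈ compactOperator (RingHom.id ℂ) H H :=
  Submodule.sum_mem _ fun i _ => (hT.clm_comp (hπ.plusHom (χ i))).comp_clm (hπ.plusHom (χ i))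

lemma IsStarRep.cutDown_mem_suppPlusIn (hπ : IsStarRep π) {n : ℕ}
    {χ : Fin n → C(OnePoint X, ℂ)} {S : Set (OnePoint X × OnePoint X)} (hS : IsClosed S)
    (hχ : ∀ i y x, χ i y ≠ 0 → χ i x ≠ 0 → (y, x) ∈ S) (T : H →L[ℂ] H) :
    hπ.cutDown χ T ∈ suppPlusIn π S := by
  refine Submodule.sum_mem _ fun i _ => ?_
  rintro ⟨y, x⟩ hp
  by_contra hpS
  obtain ⟨V, U, hV, hyV, hU, hxU, hVU⟩ :=
    mem_nhds_prod_iff'.1 (hS.isOpen_compl.mem_nhds (show (y, x) ∈ Sᶜ from hpS))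
  obtain ⟨f, g, hf, hg, h⟩ := hp U V hU hV hxU hyV
  refine h ?_
  have : g * χ i = 0 ∨ χ i * f = 0 := by
    by_contra! hne
    obtain ⟨z, hz⟩ := DFunLike.ne_iff.1 hne.1
    obtain ⟨w, hw⟩ := DFunLike.ne_iff.1 hne.2
    rw [ContinuousMap.mul_apply, ContinuousMap.zero_apply, mul_ne_zero_iff] at hz hw
    exact hVU (Set.mk_mem_prod (hg (subset_tsupport g hz.1)) (hf (subset_tsupport f hw.2)))
      (hχ i z w hz.2 hw.1)
  calc _ = hπ.plusHom (g * χ i) * T * hπ.plusHom (χ i * f) := by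
        rw [_root_.map_mul, _root_.map_mul]
        simp only [← hπ.plusHom_apply, ← ContinuousLinearMap.mul_def, mul_assoc]
    _ = 0 := by rcases this with h | h <;> simp [h]

lemma IsStarRep.plusHom_mul [T2Space X] (hπ : IsStarRep π) (φ : C₀(X, ℂ)) (χ : C(OnePoint X, ℂ)) :
    ∃ ψ : C₀(X, ℂ), tsupport ψ ⊆ tsupport φ ∧ π φ * hπ.plusHom χ = π ψ := by
  have h0 : (extendPlus φ * χ) OnePoint.infty = 0 := by simp
  have hval (x : X) : onePointRestrict (extendPlus φ * χ) x = φ x * χ x := by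
    simp [onePointRestrict_apply]
  refine ⟨onePointRestrict (extendPlus φ * χ), closure_mono fun x hx hφ => hx ?_, ?_⟩
  · rw [hval, hφ, zero_mul]
  · rw [← hπ.plusHom_extendPlus, ← _root_.map_mul, hπ.plusHom_apply, onePointAct, h0, zero_smul, zero_add]

lemma IsStarRep.cutDown_mem_suppIn [T2Space X] (hπ : IsStarRep π) {n : ℕ}
    (χ : Fin n → C(OnePoint X, ℂ)) {S : Set (X × X)} {T : H →L[ℂ] H} (hT : opSupport π T ⊆ S) :
    hπ.cutDown χ T ∈ suppIn π S := by
  refine Submodule.sum_mem _ fun i _ p hp => hT fun U V hU hV hxU hyV => ?_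
  obtain ⟨φ, ψ, hφ, hψ, h⟩ := hp U V hU hV hxU hyV
  obtain ⟨φ', hφ', eφ⟩ := hπ.plusHom_mul φ (χ i)
  obtain ⟨ψ', hψ', eψ⟩ := hπ.plusHom_mul ψ (χ i)
  have hcomm : hπ.plusHom (χ i) * π φ = π φ' := by
    rw [← eφ, ← hπ.plusHom_extendPlus, ← _root_.map_mul, ← _root_.map_mul, mul_comm]
  refine ⟨φ', ψ', hφ'.trans hφ, hψ'.trans hψ, ?_⟩
  rw [← hcomm, ← eψ]
  simpa only [← ContinuousLinearMap.mul_def, mul_assoc] using h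

lemma IsStarRep.tendsto_sub_cutDown (hπ : IsStarRep π) {n : ℕ} {χ : Fin n → C(OnePoint X, ℂ)}
    (hχ : ∑ i, χ i * χ i = 1) {T : ℝ → H →L[ℂ] H} (hT : CommDecay π T) :
    Tendsto (fun t => T t - hπ.cutDown χ (T t)) atTop (𝓝 0) := by
  have key (t : ℝ) : ∑ i, hπ.plusHom (χ i) * ((π (onePointRestrict (χ i))).comp (T t) -
      (T t).comp (π (onePointRestrict (χ i)))) = T t - hπ.cutDown χ (T t) := by
    have h1 : T t = ∑ i, hπ.plusHom (χ i) * hπ.plusHom (χ i) * T t := by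
      rw [← Finset.sum_mul]
      simp only [← _root_.map_mul, ← _root_.map_sum, hχ, _root_.map_one, one_mul]
    rw [IsStarRep.cutDown]
    nth_rewrite 3 [h1]
    rw [← Finset.sum_sub_distrib]
    refine Finset.sum_congr rfl fun i _ => ?_
    have h2 : π (onePointRestrict (χ i)) = hπ.plusHom (χ i) - χ i OnePoint.infty • 1 := by
      rw [hπ.plusHom_apply, onePointAct, add_sub_cancel_left]
    rw [h2, ← ContinuousLinearMap.mul_def, ← ContinuousLinearMap.mul_def, sub_mul, mul_sub (T t),
      smul_mul_assoc, mul_smul_comm, one_mul, mul_one, sub_sub_sub_cancel_right, mul_sub,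
      mul_assoc, mul_assoc]
  have h0 (i : Fin n) : Tendsto (fun t => hπ.plusHom (χ i) *
      ((π (onePointRestrict (χ i))).comp (T t) - (T t).comp (π (onePointRestrict (χ i)))))
      atTop (𝓝 0) := by
    simpa using (tendsto_zero_iff_norm_tendsto_zero.2 (hT (onePointRestrict (χ i)))).const_mul
      (hπ.plusHom (χ i))
  have := tendsto_finsetSum Finset.univ fun i _ => h0 i
  rw [Finset.sum_const_zero] at this
  exact this.congr key

lemma IsStarRep.rlalg_subset [T2Space X] [LocallyCompactSpace X] [SecondCountableTopology X]
    (hπ : IsStarRep π) : RLalg π ⊆ UnifClosure (RLalgEv π) := by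
  rintro T ⟨⟨C, hC⟩, hcont, hcpt, ⟨K, hK, hsupp⟩, hcomm⟩ ε hε
  have := secondCountableTopology_onePoint (X := X)
  obtain ⟨S, hSanti, hSclosed, hSnhds, hS⟩ :=
    exists_antitone_isClosed_nhdsSet_diagonal (Y := OnePoint X)
  choose N χ hχ hχS using fun n => exists_sum_mul_self_eq_one (hSnhds n)
  have hτ (n : ℕ) : ∃ τ : ℝ, ∀ t ≥ τ, ‖T t - hπ.cutDown (χ n) (T t)‖ ≤ ε := by
    refine eventually_atTop.1 ?_
    filter_upwards [Metric.tendsto_nhds.1 (hπ.tendsto_sub_cutDown (hχ n) hcomm) ε hε] with t ht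
    rw [dist_zero_right] at ht
    exact ht.le
  choose τ hτ using hτ
  let σ : ℕ → ℝ := fun n => max n (τ n + 2)
  let T' : ℝ → H →L[ℂ] H := fun t => T (max t 1)
  have hT' : Continuous T' :=
    hcont.comp_continuous (by fun_prop) fun t => le_max_right t 1
  let M : ℝ → Submodule ℂ (H →L[ℂ] H) := fun t =>
    compactOperator (RingHom.id ℂ) H H ⊓ suppIn π (K ×ˢ K) ⊓
      ⨅ n, ⨅ _ : σ n < t, suppPlusIn π (S n)
  obtain ⟨R, hR⟩ := exists_continuous_forall_mem_convex_of_local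
    (t := fun t => Metric.closedBall (T' t) ε ∩ M t)
    (fun t => (convex_closedBall _ _).inter ((M t).restrictScalars ℝ).convex) fun t₀ => by
      refine ⟨Set.Ioo (t₀ - 1) (t₀ + 1), Ioo_mem_nhds (by linarith) (by linarith), ?_⟩
      by_cases hne : ∃ n, σ n < t₀ + 1
      · have hfin : {n | σ n < t₀ + 1}.Finite := by
          obtain ⟨m, hm⟩ := exists_nat_gt (t₀ + 1)
          refine (Set.finite_Iio m).subset fun n hn => ?_
          have : (n : ℝ) < m := (le_max_left _ _).trans_lt (lt_trans hn hm)
          exact_mod_cast this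
        obtain ⟨m, hm, hmax⟩ := hfin.exists_maximal hne
        refine ⟨fun t => hπ.cutDown (χ m) (T' t),
          ((hπ.continuous_cutDown (χ m)).comp hT').continuousOn, fun t ht => ⟨?_, ⟨?_, ?_⟩, ?_⟩⟩
        · rw [Metric.mem_closedBall, dist_comm, dist_eq_norm]
          refine hτ m _ (le_trans ?_ (le_max_left t 1))
          have h1 : τ m + 2 < t₀ + 1 := (le_max_right _ _).trans_lt hm
          linarith [ht.1]
        · exact hπ.cutDown_mem_compactOperator _ (hcpt _ (le_max_right t 1))
        · exact hπ.cutDown_mem_suppIn _ (hsupp _ (le_max_right t 1))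
        · simp only [SetLike.mem_coe, Submodule.mem_iInf]
          intro n hn
          have hnm : n ≤ m := (le_total n m).elim id (hmax (hn.trans ht.2))
          exact hπ.cutDown_mem_suppPlusIn (hSclosed n)
            (fun i y x hy hx => hSanti hnm (hχS m i y x hy hx)) _
      · push Not at hne
        refine ⟨T', hT'.continuousOn, fun t ht => ⟨Metric.mem_closedBall_self hε.le, ⟨?_, ?_⟩, ?_⟩⟩
        · exact hcpt _ (le_max_right t 1)
        · exact hsupp _ (le_max_right t 1)
        · simp only [SetLike.mem_coe, Submodule.mem_iInf]
          intro n hn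
          linarith [hne n, ht.2]
  have hdist (t : ℝ) (ht : 1 ≤ t) : ‖T t - R t‖ ≤ ε := by
    have := (hR t).1
    rwa [Metric.mem_closedBall, dist_comm, dist_eq_norm, show T' t = T t by
      simp only [T', max_eq_left ht]] at this
  refine ⟨R, ⟨⟨C + ε, fun t ht => ?_⟩, R.continuous.continuousOn, fun t _ => (hR t).2.1.1,
    ⟨K, 1, hK, le_rfl, fun t _ => (hR t).2.1.2⟩, fun U hU hdiag => ?_⟩, hdist⟩
  · calc ‖R t‖ = ‖T t - (T t - R t)‖ := by rw [sub_sub_cancel]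
      _ ≤ C + ε := (norm_sub_le _ _).trans (add_le_add (hC t ht) (hdist t ht))
  · obtain ⟨n, hn⟩ := hS U (hU.mem_nhdsSet.2 fun p hp => by
      obtain ⟨y, x⟩ := p
      obtain rfl : y = x := hp
      exact hdiag y)
    refine ⟨max (σ n) 1, le_max_right _ _, fun t ht => ?_⟩
    have h := (hR t).2.2
    simp only [SetLike.mem_coe, Submodule.mem_iInf] at h
    exact Set.Subset.trans (h n ((le_max_left _ _).trans_lt ht)) hn

end Localization

/-- `RL^*_c(H_X)` coincides with the norm closure of `ℝ𝕃^{alg}_c(H_X)`. -/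
theorem statement1
    {X : Type*} [TopologicalSpace X] [T2Space X] [LocallyCompactSpace X]
    [SecondCountableTopology X]
    {H : Type*} [NormedAddCommGroup H] [InnerProductSpace ℂ H] [CompleteSpace H]
    [SecondCountableTopology H]
    (π : C₀(X, ℂ) → H →L[ℂ] H) (hπ : IsStarRep π) :
    RLc π = UnifClosure (RLalgEv π) := by
  exact Set.Subset.antisymm (unifClosure_subset_of_subset hπ.rlalg_subset)
    (unifClosure_subset_of_subset hπ.rlalgEv_subset)

end Stmt
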